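/- Let k be a field and let Q be a ℤ-graded k-algebra whose homogeneous components Q_i are k-subspaces. Let S be a graded k-subalgebra of Q contained in nonnegative degrees with S₀ = k·1, with dim_k S_i < ∞ for all i, and suppose S is generated as a k-algebra by its homogeneous elements of degree ≤ d for some d ≥ 1. Then the maximal right torsion extension T = T(S) of S in Q is right torsion closed over itself: if x ∈ Q satisfies x·t ∈ T for every t ∈ T ∩ ⊕_{i≥n} Q_i, for some n ≥ 0, then x ∈ T. -/

import Mathlib

variable {k : Type*} [Field k] {Q : Type*} [Ring Q] [Algebra k Q]

/-- For a graded subalgebra `S` of a `ℤ`-graded `k`-algebra `Q`, the set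
`S_{≥n} = S ∩ ⊕_{i≥n} Q_i` of elements of `S` all of whose homogeneous components
have degree at least `n`. -/
def degGE (𝒜 : ℤ → Submodule k Q) [GradedAlgebra 𝒜] (S : Subalgebra k Q) (n : ℤ) :
    Set Q :=
  {x | x ∈ S ∧ ∀ i : ℤ, i < n → GradedRing.proj 𝒜 i x = 0}

/-- The maximal right torsion extension
`T(S) = {x ∈ Q : x · S_{≥n} ⊆ S for some n ≥ 0}`. -/
def maxRightTorsExt (𝒜 : ℤ → Submodule k Q) [GradedAlgebra 𝒜] (S : Subalgebra k Q) :
    Set Q :=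
  {x | ∃ n : ℤ, 0 ≤ n ∧ ∀ s ∈ degGE 𝒜 S n, x * s ∈ S}

/-- The set `T(S)_{≥m} = T(S) ∩ ⊕_{i≥m} Q_i`. -/
def torsGE (𝒜 : ℤ → Submodule k Q) [GradedAlgebra 𝒜] (S : Subalgebra k Q) (m : ℤ) :
    Set Q :=
  {x | x ∈ maxRightTorsExt 𝒜 S ∧ ∀ i : ℤ, i < m → GradedRing.proj 𝒜 i x = 0}

theorem degGE_antitone (𝒜 : ℤ → Submodule k Q) [GradedAlgebra 𝒜] (S : Subalgebra k Q) :
    Antitone (degGE 𝒜 S) :=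
  fun _ _ h _ hx => ⟨hx.1, fun i hi => hx.2 i (hi.trans_le h)⟩

theorem proj_eq_zero_of_mem_of_ne (𝒜 : ℤ → Submodule k Q) [GradedAlgebra 𝒜] {x : Q}
    {i j : ℤ} (hx : x ∈ 𝒜 i) (hij : i ≠ j) : GradedRing.proj 𝒜 j x = 0 := by
  rw [GradedRing.proj_apply, DirectSum.decompose_of_mem_ne 𝒜 hx hij]

theorem mem_degGE_of_mem (𝒜 : ℤ → Submodule k Q) [GradedAlgebra 𝒜] {S : Subalgebra k Q}
    {x : Q} {i n : ℤ} (hxS : x ∈ S) (hx : x ∈ 𝒜 i) (hn : n ≤ i) : x ∈ degGE 𝒜 S n :=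
  ⟨hxS, fun j hj => proj_eq_zero_of_mem_of_ne 𝒜 hx (by omega)⟩

theorem subset_maxRightTorsExt (𝒜 : ℤ → Submodule k Q) [GradedAlgebra 𝒜]
    (S : Subalgebra k Q) : (S : Set Q) ⊆ maxRightTorsExt 𝒜 S :=
  fun _ hx => ⟨0, le_rfl, fun _ hs => S.mul_mem hx hs.1⟩

/-- The homogeneous elements of `S` of degree less than `n`, together with the products `v * u`
of homogeneous elements of `S` with `v` of degree in `[n, n + d)`. -/
def lowOrProduct (𝒜 : ℤ → Submodule k Q) (S : Subalgebra k Q) (n d : ℤ) : Set Q :=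
  {y | y ∈ S ∧ ∃ i < n, y ∈ 𝒜 i} ∪
    {y | ∃ v ∈ S, ∃ u ∈ S, ∃ i j : ℤ, n ≤ i ∧ i < n + d ∧ v ∈ 𝒜 i ∧ u ∈ 𝒜 j ∧ v * u = y}

/-- If `S` is generated in degrees at most `d`, then modulo elements of degree less than `n`
every element of `S` lies in the right ideal generated by the components of `S` of degree in
`[n, n + d)`. -/
theorem le_span_lowOrProduct (𝒜 : ℤ → Submodule k Q) [GradedAlgebra 𝒜] (S : Subalgebra k Q)
    {n d : ℤ} (hn : 0 ≤ n) (hd : 1 ≤ d)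
    (hgen : S = Algebra.adjoin k {x : Q | x ∈ S ∧ ∃ i : ℤ, i ≤ d ∧ x ∈ 𝒜 i}) :
    Subalgebra.toSubmodule S ≤ Submodule.span k (lowOrProduct 𝒜 S n d) := by
  have hone : (1 : Q) ∈ Submodule.span k (lowOrProduct 𝒜 S n d) := by
    apply Submodule.subset_span
    have h1 : (1 : Q) ∈ 𝒜 0 := SetLike.GradedOne.one_mem
    rcases hn.eq_or_lt with rfl | hn
    · exact Or.inr ⟨1, S.one_mem, 1, S.one_mem, 0, 0, le_rfl, by omega, h1, h1, one_mul 1⟩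
    · exact Or.inl ⟨S.one_mem, 0, hn, h1⟩
  have hmul : ∀ g ∈ S, ∀ l ≤ d, g ∈ 𝒜 l → ∀ y ∈ Submodule.span k (lowOrProduct 𝒜 S n d),
      y * g ∈ Submodule.span k (lowOrProduct 𝒜 S n d) := by
    intro g hgS l hl hg y hy
    induction hy using Submodule.span_induction with
    | zero => simp
    | add a b _ _ ha hb => rw [add_mul]; exact add_mem ha hb
    | smul c a _ ha => rw [smul_mul_assoc]; exact Submodule.smul_mem _ c ha
    | mem a ha =>
      apply Submodule.subset_span
      rcases ha with ⟨haS, i, hi, ha⟩ | ⟨v, hvS, u, huS, i, j, hni, hid, hv, hu, rfl⟩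
      · have hag : a * g ∈ 𝒜 (i + l) := SetLike.GradedMul.mul_mem ha hg
        have hagS := S.mul_mem haS hgS
        rcases lt_or_ge (i + l) n with h | h
        · exact Or.inl ⟨hagS, _, h, hag⟩
        · exact Or.inr ⟨a * g, hagS, 1, S.one_mem, _, 0, h, by omega, hag,
            SetLike.GradedOne.one_mem, mul_one _⟩
      · exact Or.inr ⟨v, hvS, u * g, S.mul_mem huS hgS, i, j + l, hni, hid, hv,
          SetLike.GradedMul.mul_mem hu hg, (mul_assoc _ _ _).symm⟩
  intro s hs
  suffices h : ∀ y ∈ Submodule.span k (lowOrProduct 𝒜 S n d),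
      y * s ∈ Submodule.span k (lowOrProduct 𝒜 S n d) by
    simpa using h 1 hone
  rw [Subalgebra.mem_toSubmodule, hgen] at hs
  induction hs using Algebra.adjoin_induction with
  | mem g hg =>
    obtain ⟨hgS, l, hl, hg⟩ := hg
    exact hmul g hgS l hl hg
  | algebraMap r =>
    intro y hy
    rw [← Algebra.commutes, ← Algebra.smul_def]
    exact Submodule.smul_mem _ r hy
  | add a b _ _ ha hb => intro y hy; rw [mul_add]; exact add_mem (ha y hy) (hb y hy)
  | mul a b _ _ ha hb => intro y hy; rw [← mul_assoc]; exact hb _ (ha y hy)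

/-- A finitely generated subspace carried into `T(S)` by left multiplication by `x` has a common
torsion bound. -/
theorem exists_forall_mul_mul_mem_of_fg (𝒜 : ℤ → Submodule k Q) [GradedAlgebra 𝒜]
    (S : Subalgebra k Q) {V : Submodule k Q} (hV : V.FG) {x : Q}
    (hx : ∀ v ∈ V, x * v ∈ maxRightTorsExt 𝒜 S) :
    ∃ m : ℤ, 0 ≤ m ∧ ∀ v ∈ V, ∀ s ∈ degGE 𝒜 S m, x * v * s ∈ S := by
  obtain ⟨F, rfl⟩ := hV
  have hF : ∀ᶠ m : ℤ in Filter.atTop, ∀ v ∈ F, ∀ s ∈ degGE 𝒜 S m, x * v * s ∈ S := by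
    rw [Filter.eventually_all_finset]
    intro v hv
    obtain ⟨m, -, hm⟩ := hx v (Submodule.subset_span hv)
    filter_upwards [Filter.eventually_ge_atTop m] with m' hm' s hs
    exact hm s (degGE_antitone 𝒜 S hm' hs)
  obtain ⟨m, hm, hm0⟩ := (hF.and (Filter.eventually_ge_atTop 0)).exists
  refine ⟨m, hm0, fun v hv s hs => ?_⟩
  induction hv using Submodule.span_induction with
  | zero => simp
  | add a b _ _ ha hb => rw [mul_add, add_mul]; exact S.add_mem ha hb
  | smul c a _ ha => rw [mul_smul_comm, smul_mul_assoc]; exact S.smul_mem ha c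
  | mem a ha => exact hm a ha s hs


/-- **Corollary 7.2(1), algebraic core.** Let `Q` be a `ℤ`-graded `k`-algebra and let
`S` be a graded `k`-subalgebra of `Q` contained in nonnegative degrees, with
`S₀ = k·1`, `dim_k S_i < ∞` for all `i`, and `S` generated as a `k`-algebra by its
homogeneous elements of degree `≤ d` for some `d ≥ 1`.  Then the maximal right torsion
extension `T = T(S)` of `S` in `Q` is right torsion closed over itself: if `x ∈ Q`
satisfies `x·t ∈ T` for every `t ∈ T ∩ ⊕_{i≥n} Q_i`, for some `n ≥ 0`, then `x ∈ T`. -/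
theorem maxRightTorsExt_rightTorsionClosed (𝒜 : ℤ → Submodule k Q) [GradedAlgebra 𝒜]
    (S : Subalgebra k Q)
    (hcomp : ∀ x ∈ S, ∀ i : ℤ, GradedRing.proj 𝒜 i x ∈ S)
    (hnonneg : ∀ x ∈ S, ∀ i : ℤ, i < 0 → GradedRing.proj 𝒜 i x = 0)
    (hzero : {x : Q | x ∈ S ∧ x ∈ 𝒜 0} = Set.range (algebraMap k Q))
    (hfin : ∀ i : ℤ, Module.Finite k ↥(Subalgebra.toSubmodule S ⊓ 𝒜 i))
    (d : ℕ) (hd : 1 ≤ d)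
    (hgen : S = Algebra.adjoin k {x : Q | x ∈ S ∧ ∃ i : ℤ, i ≤ (d : ℤ) ∧ x ∈ 𝒜 i}) :
    ∀ x : Q, (∃ n : ℤ, 0 ≤ n ∧ ∀ t ∈ torsGE 𝒜 S n, x * t ∈ maxRightTorsExt 𝒜 S) →
      x ∈ maxRightTorsExt 𝒜 S := by
  rintro x ⟨n, hn, hx⟩
  have hfg : (⨆ i ∈ Finset.Ico n (n + d), Subalgebra.toSubmodule S ⊓ 𝒜 i).FG :=
    Submodule.fg_biSup _ _ fun i _ => Module.Finite.iff_fg.1 (hfin i)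
  have hV : (⨆ i ∈ Finset.Ico n (n + d), Subalgebra.toSubmodule S ⊓ 𝒜 i) ≤
      Subalgebra.toSubmodule S ⊓ ⨅ i ∈ Set.Iio n, LinearMap.ker (GradedAlgebra.proj 𝒜 i) := by
    refine iSup₂_le fun i hi v hv => ⟨hv.1, ?_⟩
    simp only [SetLike.mem_coe, Submodule.mem_iInf]
    exact fun j hj => (mem_degGE_of_mem 𝒜 hv.1 hv.2 (Finset.mem_Ico.1 hi).1).2 j hj
  obtain ⟨m, hm, hxm⟩ := exists_forall_mul_mul_mem_of_fg 𝒜 S hfg (x := x) fun v hv => by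
    obtain ⟨hvS, hv⟩ := hV hv
    simp only [SetLike.mem_coe, Submodule.mem_iInf] at hv
    exact hx v ⟨subset_maxRightTorsExt 𝒜 S hvS, hv⟩
  have hproj : ∀ y ∈ S, ∀ e ≥ n + d + m, x * GradedRing.proj 𝒜 e y ∈ S := by
    intro y hy e he
    replace hy := le_span_lowOrProduct 𝒜 S hn (by exact_mod_cast hd) hgen hy
    induction hy using Submodule.span_induction with
    | zero => simp
    | add a b _ _ ha hb => rw [map_add, mul_add]; exact S.add_mem ha hb
    | smul c a _ ha =>
      change x * GradedAlgebra.proj 𝒜 e (c • a) ∈ S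
      rw [map_smul, mul_smul_comm]
      exact S.smul_mem ha c
    | mem a ha =>
      rcases ha with ⟨-, i, hi, ha⟩ | ⟨v, hvS, u, huS, i, j, hni, hid, hv, hu, rfl⟩
      · rw [proj_eq_zero_of_mem_of_ne 𝒜 ha (by omega), mul_zero]
        exact S.zero_mem
      · have hvu : v * u ∈ 𝒜 (i + j) := SetLike.GradedMul.mul_mem hv hu
        by_cases hij : i + j = e
        · rw [GradedRing.proj_apply, DirectSum.decompose_of_mem_same 𝒜 (hij ▸ hvu), ← mul_assoc]
          exact hxm v (Submodule.mem_iSup_of_mem i (Submodule.mem_iSup_of_mem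
            (Finset.mem_Ico.2 ⟨hni, hid⟩) ⟨hvS, hv⟩)) u
            (mem_degGE_of_mem 𝒜 huS hu (by omega))
        · rw [proj_eq_zero_of_mem_of_ne 𝒜 hvu hij, mul_zero]
          exact S.zero_mem
  refine ⟨n + d + m, by omega, fun s hs => ?_⟩
  classical
  rw [← DirectSum.sum_support_decompose 𝒜 s, Finset.mul_sum]
  refine S.sum_mem fun e _ => ?_
  rw [← GradedRing.proj_apply]
  rcases lt_or_ge e (n + d + m) with he | he
  · rw [hs.2 e he, mul_zero]
    exact S.zero_mem
  · exact hproj s hs.1 e he
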